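/- arXiv:2311.06160 — 2 statements merged into one kernel-verified Lean document; each statement's English description precedes it below -/
import Mathlib

section
/- Fix M > 0. Suppose x̄* maximizes f̄(x) = ∑_{(r,v) ∈ E} (M − T_{rv}) x_{rv} over the relaxed feasible region P̄, that x̄* is integral (x̄*_{rv} ∈ ℤ for every (r,v) ∈ E), and that x* ∈ P satisfies M > f(x*) − f(x̄*), where f(x) = ∑_{(r,v) ∈ E} T_{rv} x_{rv}. Then ∑_{(r,v) ∈ E} x̄*_{rv} = |R|; in particular ∑_{v : (r,v) ∈ E} x̄*_{rv} = 1 for every r ∈ R, so x̄* ∈ P. -/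
open Finset

/-- The feasible region `P` of LP(G_U). -/
def feasibleLPU {R V : Type*} [DecidableEq R] [DecidableEq V]
    (E : Finset (R × V)) (Qb : V → ℕ) : Set (R × V → ℝ) :=
  {x | (∀ e, e ∉ E → x e = 0) ∧ (∀ e ∈ E, 0 ≤ x e) ∧
    (∀ r, ∑ e ∈ E.filter (fun e => e.1 = r), x e = 1) ∧
    (∀ v, ∑ e ∈ E.filter (fun e => e.2 = v), x e ≤ (Qb v : ℝ))}

/-- The relaxed feasible region `P̄` of LP̄(G_U). -/
def relaxedLPU {R V : Type*} [DecidableEq R] [DecidableEq V]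
    (E : Finset (R × V)) (Qb : V → ℕ) : Set (R × V → ℝ) :=
  {x | (∀ e, e ∉ E → x e = 0) ∧ (∀ e ∈ E, 0 ≤ x e) ∧
    (∀ r, ∑ e ∈ E.filter (fun e => e.1 = r), x e ≤ 1) ∧
    (∀ v, ∑ e ∈ E.filter (fun e => e.2 = v), x e ≤ (Qb v : ℝ))}

/-- If `M > 0`, `x̄*` is an integral maximizer of `f̄(x) = ∑ (M − T_{rv}) x_{rv}` over `P̄`,
and `x* ∈ P` satisfies `M > f(x*) − f(x̄*)`, then `∑ x̄*_{rv} = |R|`; in particular every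
request row of `x̄*` sums to one, so `x̄* ∈ P`. -/
theorem stmt8 {R V : Type*} [Fintype R] [Fintype V] [DecidableEq R] [DecidableEq V]
    (E : Finset (R × V)) (Qb : V → ℕ) (hQb : ∀ v, 0 < Qb v)
    (T : R × V → ℝ) (hT : ∀ e ∈ E, 0 ≤ T e)
    (M : ℝ) (hM : 0 < M)
    (xbar : R × V → ℝ) (hxbar : xbar ∈ relaxedLPU E Qb)
    (hmax : ∀ y ∈ relaxedLPU E Qb,
      ∑ e ∈ E, (M - T e) * y e ≤ ∑ e ∈ E, (M - T e) * xbar e)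
    (hint : ∀ e ∈ E, ∃ n : ℤ, xbar e = (n : ℝ))
    (xstar : R × V → ℝ) (hxstar : xstar ∈ feasibleLPU E Qb)
    (hMgt : M > (∑ e ∈ E, T e * xstar e) - (∑ e ∈ E, T e * xbar e)) :
    (∑ e ∈ E, xbar e) = (Fintype.card R : ℝ) ∧
      (∀ r : R, ∑ e ∈ E.filter (fun e => e.1 = r), xbar e = 1) ∧
      xbar ∈ feasibleLPU E Qb := by
  obtain ⟨hzero, hnonneg, hrow, hcol⟩ := hxbar
  obtain ⟨szero, snonneg, srow, scol⟩ := hxstar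
  have hle := hmax xstar ⟨szero, snonneg, fun r => (srow r).le, scol⟩
  have hfib (x : R × V → ℝ) :
      ∑ r : R, ∑ e ∈ E.filter (fun e => e.1 = r), x e = ∑ e ∈ E, x e :=
    Finset.sum_fiberwise E (fun e => e.1) x
  have hstar : ∑ e ∈ E, xstar e = (Fintype.card R : ℝ) := by
    simp [← hfib xstar, srow]
  have hbar : ∑ e ∈ E, xbar e ≤ (Fintype.card R : ℝ) := by
    rw [← hfib xbar]
    simpa using Finset.sum_le_sum fun r (_ : r ∈ Finset.univ) => hrow r
  have hgap : (Fintype.card R : ℝ) - 1 < ∑ e ∈ E, xbar e := by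
    simp only [sub_mul, Finset.sum_sub_distrib, ← Finset.mul_sum] at hle
    rw [hstar] at hle
    by_contra! h
    nlinarith [mul_le_mul_of_nonneg_left h hM.le]
  have hsum : ∑ e ∈ E, xbar e = (Fintype.card R : ℝ) := by
    choose! n hn using hint
    rw [Finset.sum_congr rfl hn] at hbar hgap ⊢
    norm_cast at hbar hgap ⊢
    have : (Fintype.card R : ℤ) - 1 < ∑ e ∈ E, n e := by exact_mod_cast hgap
    omega
  have hrows (r : R) : ∑ e ∈ E.filter (fun e => e.1 = r), xbar e = 1 := by
    refine (Finset.sum_eq_sum_iff_of_le fun r _ => hrow r).1 ?_ r (Finset.mem_univ r)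
    simp [hfib xbar, hsum]
  exact ⟨hsum, hrows, hzero, hnonneg, hrows, hcol⟩
end

section
/- Suppose the feasible region P of LP(G_U) is nonempty and every request r ∈ R is incident to at least one edge. Set M = ( ∑_{r ∈ R} max{ T_{rv} : (r,v) ∈ E } ) + ε for any ε > 0. Then every x̄* that is an extreme point of P̄ maximizing f̄(x) = ∑_{(r,v) ∈ E} (M − T_{rv}) x_{rv} over P̄ belongs to P and minimizes f(x) = ∑_{(r,v) ∈ E} T_{rv} x_{rv} over P; that is, x̄* is an optimal solution of LP(G_U). -/
open Finset

/-- A direction that raises the total of row `r` by one, keeps every other row total, and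
respects the constraints of `relaxedLPU` that are tight at `x`. -/
def IsAugmenting {R V : Type*} [DecidableEq R] [DecidableEq V]
    (E : Finset (R × V)) (Qb : V → ℕ) (x : R × V → ℝ) (r : R) (d : R × V → ℝ) : Prop :=
  (∀ e, e ∉ E → d e = 0) ∧ (∀ e ∈ E, x e = 0 → 0 ≤ d e) ∧
    (∀ s, ∑ e ∈ E.filter (fun e => e.1 = s), d e = if s = r then 1 else 0) ∧
    (∀ v, ∑ e ∈ E.filter (fun e => e.2 = v), x e = (Qb v : ℝ) →
      ∑ e ∈ E.filter (fun e => e.2 = v), d e ≤ 0)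

section Augmenting

variable {R V : Type*} [DecidableEq R] [DecidableEq V]
  {E : Finset (R × V)} {Qb : V → ℕ} {x y : R × V → ℝ}

lemma isAugmenting_single {r : R} {v : V} (he : (r, v) ∈ E)
    (hv : ∑ e ∈ E.filter (fun e => e.2 = v), x e ≠ (Qb v : ℝ)) :
    IsAugmenting E Qb x r (Pi.single (r, v) 1) := by
  refine ⟨fun e h => ?_, fun e _ _ => ?_, fun s => ?_, fun w hw => ?_⟩
  · exact Pi.single_eq_of_ne (by rintro rfl; exact h he) _
  · by_cases h : e = (r, v)
    · subst h; simp
    · simp [Pi.single_eq_of_ne h]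
  · rw [Finset.sum_pi_single']
    simp [he, eq_comm]
  · have hvw : v ≠ w := by rintro rfl; exact hv hw
    rw [Finset.sum_pi_single']
    simp [hvw]

lemma IsAugmenting.reroute {r s : R} {v : V} {d : R × V → ℝ} (hd : IsAugmenting E Qb x s d)
    (he : (r, v) ∈ E) (hs : (s, v) ∈ E) (hx : x (s, v) ≠ 0) :
    IsAugmenting E Qb x r (Pi.single (r, v) 1 - Pi.single (s, v) 1 + d) := by
  obtain ⟨h0, hpos, hrow, hcol⟩ := hd
  refine ⟨fun e h => ?_, fun e h hxe => ?_, fun t => ?_, fun w hw => ?_⟩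
  · have h1 : e ≠ (r, v) := by rintro rfl; exact h he
    have h2 : e ≠ (s, v) := by rintro rfl; exact h hs
    simp [Pi.single_eq_of_ne h1, Pi.single_eq_of_ne h2, h0 e h]
  · have h2 : e ≠ (s, v) := by rintro rfl; exact hx hxe
    have h3 : (0 : ℝ) ≤ (Pi.single (r, v) 1 : R × V → ℝ) e := by
      by_cases h1 : e = (r, v)
      · subst h1; simp
      · simp [Pi.single_eq_of_ne h1]
    simpa [Pi.single_eq_of_ne h2] using add_nonneg h3 (hpos e h hxe)
  · simp only [Pi.add_apply, Pi.sub_apply, Finset.sum_add_distrib, Finset.sum_sub_distrib,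
      Finset.sum_pi_single', hrow]
    simp [he, hs, eq_comm]
  · simp only [Pi.add_apply, Pi.sub_apply, Finset.sum_add_distrib, Finset.sum_sub_distrib,
      Finset.sum_pi_single']
    simpa [he, hs] using hcol w hw

/-- A Hall-type count: if some row outside `U` is deficient, then some row outside `U` has an edge
to a column that is either unsaturated or used by a row of `U`. -/
lemma exists_slack_or_shared_edge [Fintype R] (hx : x ∈ relaxedLPU E Qb)
    (hy : y ∈ feasibleLPU E Qb) {U : Finset R} {r₀ : R} (hr₀ : r₀ ∉ U)
    (hlt : ∑ e ∈ E.filter (fun e => e.1 = r₀), x e < 1) :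
    ∃ r ∉ U, ∃ v, (r, v) ∈ E ∧ (∑ e ∈ E.filter (fun e => e.2 = v), x e ≠ (Qb v : ℝ) ∨
      ∃ s ∈ U, (s, v) ∈ E ∧ x (s, v) ≠ 0) := by
  obtain ⟨_, _, hxr, _⟩ := hx
  obtain ⟨_, hy0, hyr, hyc⟩ := hy
  by_contra! hcon
  set F := E.filter (fun e => e.1 ∉ U) with hF
  set W := F.image Prod.snd with hW
  set G := E.filter (fun e => e.2 ∈ W) with hG
  have hrows : ∀ z : R × V → ℝ,
      ∑ r ∈ Uᶜ, ∑ e ∈ E.filter (fun e => e.1 = r), z e = ∑ e ∈ F, z e := by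
    intro z
    rw [← Finset.sum_fiberwise_of_maps_to (s := F) (t := Uᶜ) (g := Prod.fst)
      (fun e he => by simpa using (Finset.mem_filter.1 he).2)]
    refine Finset.sum_congr rfl fun r hr => Finset.sum_congr ?_ fun _ _ => rfl
    ext e
    simp only [hF, Finset.mem_filter, Finset.mem_compl] at hr ⊢
    constructor
    · rintro ⟨h, rfl⟩; exact ⟨⟨h, hr⟩, rfl⟩
    · rintro ⟨⟨h, _⟩, h'⟩; exact ⟨h, h'⟩
  have hcols : ∀ z : R × V → ℝ,
      ∑ v ∈ W, ∑ e ∈ E.filter (fun e => e.2 = v), z e = ∑ e ∈ G, z e := by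
    intro z
    rw [← Finset.sum_fiberwise_of_maps_to (s := G) (t := W) (g := Prod.snd)
      (fun e he => (Finset.mem_filter.1 he).2)]
    refine Finset.sum_congr rfl fun v hv => Finset.sum_congr ?_ fun _ _ => rfl
    ext e
    simp only [hG, Finset.mem_filter]
    constructor
    · rintro ⟨h, rfl⟩; exact ⟨⟨h, hv⟩, rfl⟩
    · rintro ⟨⟨h, _⟩, h'⟩; exact ⟨h, h'⟩
  have hFG : F ⊆ G := fun e he =>
    Finset.mem_filter.2 ⟨(Finset.mem_filter.1 he).1, Finset.mem_image_of_mem _ he⟩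
  have hWmem : ∀ v ∈ W, ∃ r ∉ U, (r, v) ∈ E := by
    intro v hv
    obtain ⟨e, he, rfl⟩ := Finset.mem_image.1 hv
    exact ⟨e.1, (Finset.mem_filter.1 he).2, (Finset.mem_filter.1 he).1⟩
  have hyFG : ∑ e ∈ F, y e ≤ ∑ e ∈ G, y e :=
    Finset.sum_le_sum_of_subset_of_nonneg hFG
      fun e he _ => hy0 e (Finset.mem_filter.1 he).1
  have hyx : ∑ e ∈ G, y e ≤ ∑ e ∈ G, x e := by
    rw [← hcols, ← hcols]
    refine Finset.sum_le_sum fun v hv => ?_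
    obtain ⟨r, hr, hrv⟩ := hWmem v hv
    rw [(hcon r hr v hrv).1]
    exact hyc v
  have hxFG : ∑ e ∈ F, x e = ∑ e ∈ G, x e := by
    refine Finset.sum_subset hFG fun e he hne => ?_
    obtain ⟨heE, heW⟩ := Finset.mem_filter.1 he
    obtain ⟨r, hr, hrv⟩ := hWmem _ heW
    have heU : e.1 ∈ U := by
      by_contra h
      exact hne (Finset.mem_filter.2 ⟨heE, h⟩)
    exact (hcon r hr e.2 hrv).2 e.1 heU heE
  have hstrict : ∑ e ∈ F, x e < ∑ e ∈ F, y e := by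
    rw [← hrows, ← hrows]
    refine Finset.sum_lt_sum (fun r _ => ?_) ⟨r₀, by simpa using hr₀, ?_⟩
    · rw [hyr]; exact hxr r
    · rw [hyr]; exact hlt
  linarith

/-- A deficient row admits an augmenting direction whose cost is at most the sum of the row
bounds `m` on the edge costs. -/
lemma exists_isAugmenting [Fintype R] (hx : x ∈ relaxedLPU E Qb)
    (hy : y ∈ feasibleLPU E Qb) {T : R × V → ℝ} (hT : ∀ e ∈ E, 0 ≤ T e) {m : R → ℝ}
    (hm0 : ∀ r, 0 ≤ m r) (hm : ∀ e ∈ E, T e ≤ m e.1) {r₀ : R}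
    (hlt : ∑ e ∈ E.filter (fun e => e.1 = r₀), x e < 1) :
    ∃ d, IsAugmenting E Qb x r₀ d ∧ ∑ e ∈ E, T e * d e ≤ ∑ r, m r := by
  classical
  let good : Finset R → Prop := fun U =>
    ∀ r ∈ U, ∃ d, IsAugmenting E Qb x r d ∧ ∑ e ∈ E, T e * d e ≤ ∑ s ∈ U, m s
  have hsingle : ∀ e ∈ E, ∑ e' ∈ E, T e' * (Pi.single e 1 : R × V → ℝ) e' = T e := by
    intro e he
    simp [Pi.single_apply, he]
  obtain ⟨U, hU, hUmax⟩ := Finset.exists_max_image (Finset.univ.filter good) Finset.card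
    ⟨∅, by simp [good]⟩
  have hUg : good U := (Finset.mem_filter.1 hU).2
  by_cases hr₀ : r₀ ∈ U
  · obtain ⟨d, hd, hc⟩ := hUg r₀ hr₀
    exact ⟨d, hd, hc.trans (Finset.sum_le_sum_of_subset_of_nonneg (Finset.subset_univ _)
      fun r _ _ => hm0 r)⟩
  exfalso
  obtain ⟨r, hr, v, he, hv⟩ := exists_slack_or_shared_edge hx hy hr₀ hlt
  have hgood : good (insert r U) := by
    intro t ht
    rw [Finset.sum_insert hr]
    rcases Finset.mem_insert.1 ht with rfl | htU
    · rcases hv with hv | ⟨s, hsU, hs, hxs⟩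
      · refine ⟨_, isAugmenting_single he hv, ?_⟩
        rw [hsingle _ he]
        have := Finset.sum_nonneg (s := U) fun r _ => hm0 r
        linarith [hm _ he]
      · obtain ⟨d, hd, hc⟩ := hUg s hsU
        refine ⟨_, hd.reroute he hs hxs, ?_⟩
        simp only [Pi.add_apply, Pi.sub_apply, mul_add, mul_sub, Finset.sum_add_distrib,
          Finset.sum_sub_distrib, hsingle _ he, hsingle _ hs]
        linarith [hm _ he, hT _ hs]
    · obtain ⟨d, hd, hc⟩ := hUg t htU
      exact ⟨d, hd, by linarith [hm0 r]⟩
  have := hUmax (insert r U) (Finset.mem_filter.2 ⟨Finset.mem_univ _, hgood⟩)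
  rw [Finset.card_insert_of_notMem hr] at this
  omega

end Augmenting

lemma eventually_add_mul_le {a b c : ℝ} (hac : a ≤ c) (hb : a = c → b ≤ 0) :
    ∀ᶠ t in nhdsWithin (0 : ℝ) (Set.Ioi 0), a + t * b ≤ c := by
  rcases hac.eq_or_lt with h | h
  · filter_upwards [self_mem_nhdsWithin] with t ht
    have := mul_nonpos_of_nonneg_of_nonpos (le_of_lt (Set.mem_Ioi.1 ht)) (hb h)
    linarith
  · have hcont : Filter.Tendsto (fun t : ℝ => a + t * b) (nhds 0) (nhds a) := by
      have : Continuous fun t : ℝ => a + t * b := by fun_prop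
      simpa using this.tendsto 0
    exact nhdsWithin_le_nhds ((hcont.eventually_lt_const h).mono fun _ h => h.le)

lemma IsAugmenting.exists_pos_mem_relaxedLPU {R V : Type*} [Finite R] [Finite V]
    [DecidableEq R] [DecidableEq V] {E : Finset (R × V)} {Qb : V → ℕ} {x d : R × V → ℝ} {r : R}
    (hd : IsAugmenting E Qb x r d) (hx : x ∈ relaxedLPU E Qb)
    (hlt : ∑ e ∈ E.filter (fun e => e.1 = r), x e < 1) :
    ∃ t : ℝ, 0 < t ∧ (fun e => x e + t * d e) ∈ relaxedLPU E Qb := by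
  obtain ⟨d0, dpos, drow, dcol⟩ := hd
  obtain ⟨x0, xpos, xrow, xcol⟩ := hx
  have h1 : ∀ᶠ t in nhdsWithin (0 : ℝ) (Set.Ioi 0), ∀ e, e ∈ E → 0 ≤ x e + t * d e := by
    refine Filter.eventually_all.2 fun e => ?_
    by_cases he : e ∈ E
    · filter_upwards [eventually_add_mul_le (a := -x e) (b := -d e) (c := 0)
        (by linarith [xpos e he]) (fun h => by linarith [dpos e he (by linarith)])] with t ht _
      linarith
    · exact Filter.Eventually.of_forall fun _ h => absurd h he
  have h2 : ∀ᶠ t in nhdsWithin (0 : ℝ) (Set.Ioi 0), ∀ s,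
      ∑ e ∈ E.filter (fun e => e.1 = s), x e + t * ∑ e ∈ E.filter (fun e => e.1 = s), d e ≤ 1 := by
    refine Filter.eventually_all.2 fun s => eventually_add_mul_le (xrow s) fun h => ?_
    have : s ≠ r := by rintro rfl; exact hlt.ne h
    rw [drow, if_neg this]
  have h3 : ∀ᶠ t in nhdsWithin (0 : ℝ) (Set.Ioi 0), ∀ v,
      ∑ e ∈ E.filter (fun e => e.2 = v), x e + t * ∑ e ∈ E.filter (fun e => e.2 = v), d e ≤ Qb v :=
    Filter.eventually_all.2 fun v => eventually_add_mul_le (xcol v) (dcol v)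
  obtain ⟨t, ht, h1, h2, h3⟩ := (Filter.Eventually.and
    (self_mem_nhdsWithin : ∀ᶠ t in nhdsWithin (0 : ℝ) (Set.Ioi 0), t ∈ Set.Ioi 0)
    (h1.and (h2.and h3))).exists
  refine ⟨t, ht, fun e he => by simp [x0 e he, d0 e he], h1, fun s => ?_, fun v => ?_⟩
  · simpa only [Finset.sum_add_distrib, Finset.mul_sum] using h2 s
  · simpa only [Finset.sum_add_distrib, Finset.mul_sum] using h3 v

/-- If `P` is nonempty, every request is incident to an edge, and
`M = (∑_{r ∈ R} max{T_{rv} : (r,v) ∈ E}) + ε` with `ε > 0`, then every extreme point `x̄*`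
of `P̄` that maximizes `f̄(x) = ∑ (M − T_{rv}) x_{rv}` over `P̄` belongs to `P` and
minimizes `f(x) = ∑ T_{rv} x_{rv}` over `P`, i.e. it is optimal for LP(G_U). -/
theorem stmt10 {R V : Type*} [Fintype R] [Fintype V] [DecidableEq R] [DecidableEq V]
    (E : Finset (R × V)) (Qb : V → ℕ) (hQb : ∀ v, 0 < Qb v)
    (T : R × V → ℝ) (hT : ∀ e ∈ E, 0 ≤ T e)
    (hdegR : ∀ r : R, ∃ v, (r, v) ∈ E)
    (hPne : (feasibleLPU E Qb).Nonempty)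
    (ε : ℝ) (hε : 0 < ε) (M : ℝ)
    (hM : M = (∑ r : R, (E.filter (fun e => e.1 = r)).sup'
        (by obtain ⟨v, hv⟩ := hdegR r; exact ⟨(r, v), by simp [hv]⟩) T) + ε)
    (xbar : R × V → ℝ)
    (hxbar : xbar ∈ Set.extremePoints ℝ (relaxedLPU E Qb))
    (hmax : ∀ y ∈ relaxedLPU E Qb,
      ∑ e ∈ E, (M - T e) * y e ≤ ∑ e ∈ E, (M - T e) * xbar e) :
    xbar ∈ feasibleLPU E Qb ∧
      ∀ y ∈ feasibleLPU E Qb, ∑ e ∈ E, T e * xbar e ≤ ∑ e ∈ E, T e * y e := by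
  have hx := hxbar.1
  have htot : ∀ z : R × V → ℝ, ∑ e ∈ E, (M - T e) * z e =
      M * ∑ r, ∑ e ∈ E.filter (fun e => e.1 = r), z e - ∑ e ∈ E, T e * z e := by
    intro z
    rw [Finset.sum_fiberwise]
    simp only [sub_mul, Finset.sum_sub_distrib, Finset.mul_sum]
  have hP : xbar ∈ feasibleLPU E Qb := by
    refine ⟨hx.1, hx.2.1, fun r => ?_, hx.2.2.2⟩
    by_contra hne
    have hlt := lt_of_le_of_ne (hx.2.2.1 r) hne
    obtain ⟨y, hy⟩ := hPne
    have hm : ∀ e (he : e ∈ E), T e ≤ (E.filter (fun e' => e'.1 = e.1)).sup'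
        ⟨e, by simp [he]⟩ T := fun e he => Finset.le_sup' T (by simp [he])
    have hrow : ∀ r, (E.filter (fun e => e.1 = r)).Nonempty := fun r =>
      (hdegR r).elim fun v hv => ⟨(r, v), by simp [hv]⟩
    have hm0 : ∀ r, 0 ≤ (E.filter (fun e => e.1 = r)).sup' (hrow r) T := fun r =>
      (hdegR r).elim fun v hv => (hT _ hv).trans (hm _ hv)
    obtain ⟨d, hd, hcost⟩ := exists_isAugmenting hx hy hT hm0 hm hlt
    obtain ⟨t, ht, hmem⟩ := hd.exists_pos_mem_relaxedLPU hx hlt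
    have hle := hmax _ hmem
    have hgain : ∑ e ∈ E, (M - T e) * d e = M - ∑ e ∈ E, T e * d e := by
      rw [htot]
      simp [hd.2.2.1]
    have hexp : ∑ e ∈ E, (M - T e) * (xbar e + t * d e) =
        ∑ e ∈ E, (M - T e) * xbar e + t * ∑ e ∈ E, (M - T e) * d e := by
      rw [Finset.mul_sum, ← Finset.sum_add_distrib]
      exact Finset.sum_congr rfl fun e _ => by ring
    have hpos : 0 < t * ∑ e ∈ E, (M - T e) * d e :=
      mul_pos ht (by rw [hgain]; linarith)
    linarith
  refine ⟨hP, fun y hy => ?_⟩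
  have hle := hmax y ⟨hy.1, hy.2.1, fun r => (hy.2.2.1 r).le, hy.2.2.2⟩
  rw [htot, htot] at hle
  simp only [hP.2.2.1, hy.2.2.1] at hle
  linarith
end
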